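/- Let φ be a comparison function, (X, d) a metric space, and (E, ‖·‖_E) a normed space. A non-empty subset A of BLip_φ(X,E) is precompact (with respect to the norm ⦀f⦀_φ = ‖f‖_∞ + |f|_φ) if and only if the set A − A satisfies both the condition (L) and the condition (B), and the sections A(x) := {f(x) : f ∈ A} are precompact in E for every x ∈ X. -/

import Mathlib

open Pointwise Metric

/-- A comparison function. -/
structure IsCompFun (φ : ℝ → ℝ) : Prop where
  nonneg : ∀ t : ℝ, 0 ≤ t → 0 ≤ φ t
  map_zero : φ 0 = 0
  right_cont : ContinuousWithinAt φ (Set.Ici 0) 0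
  concave : ConcaveOn ℝ (Set.Ici 0) φ
  ne_zero : ∃ t : ℝ, 0 ≤ t ∧ φ t ≠ 0

/-- The Lipschitz seminorm `|f|_φ`. -/
noncomputable def lipSemi {X E : Type*} [MetricSpace X] [NormedAddCommGroup E]
    (φ : ℝ → ℝ) (f : X → E) : ℝ :=
  sSup {r : ℝ | ∃ x y : X, x ≠ y ∧ r = ‖f x - f y‖ / φ (dist x y)}

/-- Membership in `Lip_φ(X,E)`. -/
def MemLip {X E : Type*} [MetricSpace X] [NormedAddCommGroup E]
    (φ : ℝ → ℝ) (f : X → E) : Prop :=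
  BddAbove {r : ℝ | ∃ x y : X, x ≠ y ∧ r = ‖f x - f y‖ / φ (dist x y)}

/-- The norm `⦀f⦀_φ = ‖f‖_∞ + |f|_φ` of `BLip_φ(X,E)`. -/
noncomputable def bLipNorm {X E : Type*} [MetricSpace X] [NormedAddCommGroup E]
    (φ : ℝ → ℝ) (f : X → E) : ℝ :=
  (⨆ x : X, ‖f x‖) + lipSemi φ f

/-- Precompactness of `A` with respect to the gauge `N`. -/
def Precomp {α : Type*} [Sub α] (N : α → ℝ) (A : Set α) : Prop :=
  ∀ ε : ℝ, 0 < ε → ∃ T : Set α, T ⊆ A ∧ T.Finite ∧ ∀ f ∈ A, ∃ g ∈ T, N (f - g) ≤ ε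

/-- Condition (L). -/
def CondL {X E : Type*} [MetricSpace X] [NormedAddCommGroup E]
    (φ : ℝ → ℝ) (S : Set (X → E)) : Prop :=
  ∀ ε : ℝ, 0 < ε → ∃ (N : ℕ) (U : Fin N → Set (X × X)),
    (∀ i, U i ⊆ {p : X × X | p.1 ≠ p.2}) ∧
    {p : X × X | p.1 ≠ p.2} ⊆ ⋃ i, U i ∧
    ∀ i : Fin N, ∀ p ∈ U i, ∀ q ∈ U i, ∀ f ∈ S,
      |‖f p.1 - f p.2‖ / φ (dist p.1 p.2) - ‖f q.1 - f q.2‖ / φ (dist q.1 q.2)| ≤ ε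

/-- Condition (B) for a set of (bounded) maps `X → E`. -/
def CondB {X E : Type*} [NormedAddCommGroup E] (S : Set (X → E)) : Prop :=
  ∀ ε : ℝ, 0 < ε → ∃ (N : ℕ) (U : Fin N → Set X),
    (⋃ i, U i) = Set.univ ∧
    ∀ i : Fin N, ∀ x ∈ U i, ∀ y ∈ U i, ∀ f ∈ S, |‖f x‖ - ‖f y‖| ≤ ε

theorem totallyBounded_of_eval_image {ι : Type*} {E : ι → Type*} [∀ i, UniformSpace (E i)]
    {s : Set (∀ i, E i)} (h : ∀ i, TotallyBounded (Function.eval i '' s)) :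
    TotallyBounded s := by
  cases isEmpty_or_nonempty ι
  · exact s.toFinite.totallyBounded
  rw [totallyBounded_iff_ultrafilter]
  intro F hF
  rw [cauchy_pi_iff]
  intro i
  refine totallyBounded_iff_ultrafilter.1 (h i) (F.map (Function.eval i)) ?_
  rw [Ultrafilter.coe_map, ← Filter.map_principal]
  exact Filter.map_mono hF

theorem exists_finite_net_of_eval {α ι E : Type*} [Fintype ι] [PseudoMetricSpace E]
    {A : Set α} (Φ : α → ι → E) (h : ∀ i, TotallyBounded ((fun a => Φ a i) '' A))
    {δ : ℝ} (hδ : 0 < δ) :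
    ∃ T ⊆ A, T.Finite ∧ ∀ a ∈ A, ∃ b ∈ T, ∀ i, dist (Φ a i) (Φ b i) < δ := by
  have hΦ : TotallyBounded (Φ '' A) := by
    refine totallyBounded_of_eval_image fun i => ?_
    rw [Set.image_image]
    exact h i
  obtain ⟨t, htA, htf, ht⟩ := Metric.finite_approx_of_totallyBounded hΦ δ hδ
  obtain ⟨T, hTA, hTf, rfl⟩ := Set.exists_subset_image_finite_and (p := fun u => u = t) |>.1
    ⟨t, htA, htf, rfl⟩
  refine ⟨T, hTA, hTf, fun a ha => ?_⟩
  have := ht (Set.mem_image_of_mem Φ ha)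
  simp only [Set.mem_iUnion, Set.exists_mem_image, mem_ball, exists_prop] at this
  obtain ⟨b, hb, hab⟩ := this
  exact ⟨b, hb, fun i => (dist_le_pi_dist _ _ i).trans_lt hab⟩

/-- A family of real functions that has finite nets of bounded functions in the uniform distance
has uniformly small oscillation on the pieces of a finite cover. -/
theorem exists_finite_cover_osc_le {α β : Type*} {S K : Set β} (q : β → α → ℝ) {ε : ℝ} (hε : 0 < ε)
    (hKf : K.Finite) (hKb : ∀ k ∈ K, ∃ C, ∀ a, |q k a| ≤ C)
    (hSK : ∀ s ∈ S, ∃ k ∈ K, ∀ a, |q s a - q k a| ≤ ε) :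
    ∃ (N : ℕ) (U : Fin N → Set α), (⋃ i, U i) = Set.univ ∧
      ∀ i, ∀ a ∈ U i, ∀ b ∈ U i, ∀ s ∈ S, |q s a - q s b| ≤ 4 * ε := by
  have := hKf.fintype
  obtain ⟨T, -, hTf, hT⟩ := exists_finite_net_of_eval (A := Set.univ)
    (fun (a : α) (k : K) => q k a) (fun k => by
      obtain ⟨C, hC⟩ := hKb k k.2
      refine (isCompact_closedBall (0 : ℝ) C).totallyBounded.subset ?_
      rintro _ ⟨a, -, rfl⟩
      simpa using hC a) hε
  have := hTf.fintype
  let e := Fintype.equivFin T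
  refine ⟨Fintype.card T, fun i => {a | ∀ k : K, dist (q k a) (q k (e.symm i)) < ε}, ?_, ?_⟩
  · refine Set.eq_univ_of_forall fun a => ?_
    obtain ⟨b, hb, hab⟩ := hT a trivial
    exact Set.mem_iUnion.2 ⟨e ⟨b, hb⟩, by simpa using hab⟩
  · intro i a ha b hb s hs
    obtain ⟨k, hk, hsk⟩ := hSK s hs
    have h1 := ha ⟨k, hk⟩
    have h2 := hb ⟨k, hk⟩
    have h3 := hsk a
    have h4 := hsk b
    simp only [Real.dist_eq, abs_lt, abs_le] at *
    constructor <;> linarith [h1.1, h1.2, h2.1, h2.2, h3.1, h3.2, h4.1, h4.2]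

section

variable {X E : Type*} [MetricSpace X] [NormedAddCommGroup E] {φ : ℝ → ℝ} {f g : X → E}

/-- The difference quotient of `f` with respect to `φ`. -/
noncomputable def diffQuot (φ : ℝ → ℝ) (f : X → E) (p : X × X) : ℝ :=
  ‖f p.1 - f p.2‖ / φ (dist p.1 p.2)

theorem IsCompFun.dist_nonneg (hφ : IsCompFun φ) (x y : X) : 0 ≤ φ (dist x y) :=
  hφ.nonneg _ _root_.dist_nonneg

theorem diffQuot_nonneg (hφ : IsCompFun φ) (f : X → E) (p : X × X) : 0 ≤ diffQuot φ f p :=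
  div_nonneg (norm_nonneg _) (hφ.dist_nonneg _ _)

theorem diffQuot_self (φ : ℝ → ℝ) (f : X → E) (x : X) : diffQuot φ f (x, x) = 0 := by
  simp [diffQuot]

theorem diffQuot_sub_le (hφ : IsCompFun φ) (f g : X → E) (p : X × X) :
    diffQuot φ (f - g) p ≤ diffQuot φ f p + diffQuot φ g p := by
  rw [diffQuot, diffQuot, diffQuot, ← add_div]
  refine div_le_div_of_nonneg_right ?_ (hφ.dist_nonneg _ _)
  rw [Pi.sub_apply, Pi.sub_apply, sub_sub_sub_comm]
  exact norm_sub_le _ _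

theorem abs_diffQuot_sub_le (hφ : IsCompFun φ) (f g : X → E) (p : X × X) :
    |diffQuot φ f p - diffQuot φ g p| ≤ diffQuot φ (f - g) p := by
  rw [diffQuot, diffQuot, diffQuot, ← sub_div, abs_div, abs_of_nonneg (hφ.dist_nonneg _ _)]
  refine div_le_div_of_nonneg_right ?_ (hφ.dist_nonneg _ _)
  rw [Pi.sub_apply, Pi.sub_apply, sub_sub_sub_comm]
  exact abs_norm_sub_norm_le _ _

theorem diffQuot_le_of_norm_le (hφ : IsCompFun φ) {p : X × X} {δ : ℝ} (h1 : ‖f p.1‖ ≤ δ)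
    (h2 : ‖f p.2‖ ≤ δ) : diffQuot φ f p ≤ δ * (2 / φ (dist p.1 p.2)) := by
  rw [← mul_div_assoc]
  refine div_le_div_of_nonneg_right ?_ (hφ.dist_nonneg _ _)
  linarith [norm_sub_le (f p.1) (f p.2)]

theorem MemLip.diffQuot_le_lipSemi (hf : MemLip φ f) {p : X × X} (hp : p.1 ≠ p.2) :
    diffQuot φ f p ≤ lipSemi φ f :=
  le_csSup hf ⟨p.1, p.2, hp, rfl⟩

theorem lipSemi_nonneg (hφ : IsCompFun φ) (f : X → E) : 0 ≤ lipSemi φ f := by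
  refine Real.sSup_nonneg ?_
  rintro _ ⟨x, y, -, rfl⟩
  exact diffQuot_nonneg hφ f (x, y)

theorem MemLip.sub (hφ : IsCompFun φ) (hf : MemLip φ f) (hg : MemLip φ g) :
    MemLip φ (f - g) := by
  refine ⟨lipSemi φ f + lipSemi φ g, ?_⟩
  rintro _ ⟨x, y, hxy, rfl⟩
  exact (diffQuot_sub_le hφ f g (x, y)).trans
    (add_le_add (hf.diffQuot_le_lipSemi hxy) (hg.diffQuot_le_lipSemi hxy))

/-- Membership in `BLip_φ(X,E)`. -/
def MemBLip (φ : ℝ → ℝ) (f : X → E) : Prop :=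
  MemLip φ f ∧ ∃ C : ℝ, ∀ x, ‖f x‖ ≤ C

theorem MemBLip.sub (hφ : IsCompFun φ) (hf : MemBLip φ f) (hg : MemBLip φ g) :
    MemBLip φ (f - g) := by
  obtain ⟨hf, C, hC⟩ := hf
  obtain ⟨hg, D, hD⟩ := hg
  exact ⟨hf.sub hφ hg, C + D, fun x => (norm_sub_le _ _).trans (add_le_add (hC x) (hD x))⟩

theorem MemBLip.norm_le_bLipNorm (hφ : IsCompFun φ) (hf : MemBLip φ f) (x : X) :
    ‖f x‖ ≤ bLipNorm φ f := by
  obtain ⟨-, C, hC⟩ := hf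
  have hb : BddAbove (Set.range fun x => ‖f x‖) := ⟨C, Set.forall_mem_range.2 hC⟩
  exact (le_ciSup hb x).trans (le_add_of_nonneg_right (lipSemi_nonneg hφ f))

theorem MemBLip.diffQuot_le_bLipNorm (hφ : IsCompFun φ) (hf : MemBLip φ f) (p : X × X) :
    diffQuot φ f p ≤ bLipNorm φ f := by
  have h0 : 0 ≤ ⨆ x, ‖f x‖ := Real.iSup_nonneg fun x => norm_nonneg _
  obtain ⟨x, y⟩ := p
  rcases eq_or_ne x y with rfl | hxy
  · rw [diffQuot_self]
    exact add_nonneg h0 (lipSemi_nonneg hφ f)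
  · exact (hf.1.diffQuot_le_lipSemi hxy).trans (le_add_of_nonneg_left h0)

theorem bLipNorm_le {a b : ℝ} (ha : 0 ≤ a) (hb : 0 ≤ b) (hfa : ∀ x, ‖f x‖ ≤ a)
    (hfb : ∀ p : X × X, p.1 ≠ p.2 → diffQuot φ f p ≤ b) : bLipNorm φ f ≤ a + b := by
  refine add_le_add (Real.iSup_le hfa ha) (Real.sSup_le ?_ hb)
  rintro _ ⟨x, y, hxy, rfl⟩
  exact hfb (x, y) hxy

/-- Finite nets of `A` yield finite nets of `A - A`. -/
theorem Precomp.exists_finite_net_sub (hφ : IsCompFun φ) {A : Set (X → E)}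
    (hA : Precomp (bLipNorm φ) A) (hAL : ∀ f ∈ A, MemBLip φ f) {ε : ℝ} (hε : 0 < ε) :
    ∃ K ⊆ A - A, K.Finite ∧ ∀ f ∈ A - A, ∃ g ∈ K,
      (∀ x, ‖f x - g x‖ ≤ ε) ∧ ∀ p, diffQuot φ (f - g) p ≤ ε := by
  obtain ⟨T, hTA, hTf, hT⟩ := hA (ε / 2) (half_pos hε)
  refine ⟨T - T, Set.sub_subset_sub hTA hTA, hTf.sub hTf, ?_⟩
  rintro _ ⟨f₁, hf₁, f₂, hf₂, rfl⟩
  obtain ⟨g₁, hg₁, h₁⟩ := hT f₁ hf₁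
  obtain ⟨g₂, hg₂, h₂⟩ := hT f₂ hf₂
  have m₁ := (hAL f₁ hf₁).sub hφ (hAL g₁ (hTA hg₁))
  have m₂ := (hAL f₂ hf₂).sub hφ (hAL g₂ (hTA hg₂))
  refine ⟨g₁ - g₂, Set.sub_mem_sub hg₁ hg₂, fun x => ?_, fun p => ?_⟩
  · have e : (f₁ - f₂) x - (g₁ - g₂) x = (f₁ - g₁) x - (f₂ - g₂) x := by
      simp only [Pi.sub_apply]; abel
    simp only [e]
    linarith [norm_sub_le ((f₁ - g₁) x) ((f₂ - g₂) x), m₁.norm_le_bLipNorm hφ x,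
      m₂.norm_le_bLipNorm hφ x]
  · simp only [sub_sub_sub_comm f₁ f₂ g₁ g₂]
    linarith [diffQuot_sub_le hφ (f₁ - g₁) (f₂ - g₂) p, m₁.diffQuot_le_bLipNorm hφ p,
      m₂.diffQuot_le_bLipNorm hφ p]

theorem MemBLip.of_mem_sub (hφ : IsCompFun φ) {A : Set (X → E)} (hAL : ∀ f ∈ A, MemBLip φ f)
    (hf : f ∈ A - A) : MemBLip φ f := by
  obtain ⟨f₁, hf₁, f₂, hf₂, rfl⟩ := hf
  exact (hAL f₁ hf₁).sub hφ (hAL f₂ hf₂)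

theorem Precomp.condL_sub (hφ : IsCompFun φ) {A : Set (X → E)}
    (hA : Precomp (bLipNorm φ) A) (hAL : ∀ f ∈ A, MemBLip φ f) : CondL φ (A - A) := by
  intro ε hε
  have hε4 : 0 < ε / 4 := by positivity
  obtain ⟨K, hKA, hKf, hK⟩ := hA.exists_finite_net_sub hφ hAL hε4
  obtain ⟨N, U, hU, hosc⟩ := exists_finite_cover_osc_le (S := A - A) (diffQuot φ) hε4 hKf
    (fun k hk => ⟨bLipNorm φ k, fun p => by
      rw [abs_of_nonneg (diffQuot_nonneg hφ k p)]
      exact (MemBLip.of_mem_sub hφ hAL (hKA hk)).diffQuot_le_bLipNorm hφ p⟩)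
    (fun f hf => by
      obtain ⟨g, hg, -, h⟩ := hK f hf
      exact ⟨g, hg, fun p => (abs_diffQuot_sub_le hφ f g p).trans (h p)⟩)
  refine ⟨N, fun i => U i ∩ {p | p.1 ≠ p.2}, fun i => Set.inter_subset_right, fun p hp => ?_,
    fun i p hp q hq f hf => ?_⟩
  · obtain ⟨i, hi⟩ := Set.mem_iUnion.1 (hU.symm ▸ Set.mem_univ p)
    exact Set.mem_iUnion.2 ⟨i, hi, hp⟩
  · have := hosc i p hp.1 q hq.1 f hf
    rwa [mul_div_cancel₀ _ four_ne_zero] at this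

theorem Precomp.condB_sub (hφ : IsCompFun φ) {A : Set (X → E)}
    (hA : Precomp (bLipNorm φ) A) (hAL : ∀ f ∈ A, MemBLip φ f) : CondB (A - A) := by
  intro ε hε
  have hε4 : 0 < ε / 4 := by positivity
  obtain ⟨K, hKA, hKf, hK⟩ := hA.exists_finite_net_sub hφ hAL hε4
  obtain ⟨N, U, hU, hosc⟩ := exists_finite_cover_osc_le (S := A - A)
    (fun (f : X → E) x => ‖f x‖) hε4 hKf
    (fun k hk => ⟨bLipNorm φ k, fun x => by
      rw [abs_norm]
      exact (MemBLip.of_mem_sub hφ hAL (hKA hk)).norm_le_bLipNorm hφ x⟩)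
    (fun f hf => by
      obtain ⟨g, hg, h, -⟩ := hK f hf
      exact ⟨g, hg, fun x => (abs_norm_sub_norm_le _ _).trans (h x)⟩)
  refine ⟨N, U, hU, fun i x hx y hy f hf => ?_⟩
  have := hosc i x hx y hy f hf
  rwa [mul_div_cancel₀ _ four_ne_zero] at this

theorem Precomp.totallyBounded_eval (hφ : IsCompFun φ) {A : Set (X → E)}
    (hA : Precomp (bLipNorm φ) A) (hAL : ∀ f ∈ A, MemBLip φ f) (x : X) :
    TotallyBounded ((fun f : X → E => f x) '' A) := by
  rw [Metric.totallyBounded_iff]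
  intro ε hε
  obtain ⟨T, hTA, hTf, hT⟩ := hA (ε / 2) (half_pos hε)
  refine ⟨(fun f : X → E => f x) '' T, hTf.image _, ?_⟩
  rintro _ ⟨f, hf, rfl⟩
  obtain ⟨g, hg, hfg⟩ := hT f hf
  refine Set.mem_biUnion (Set.mem_image_of_mem _ hg) ?_
  rw [mem_ball, dist_eq_norm]
  exact (((hAL f hf).sub hφ (hAL g (hTA hg))).norm_le_bLipNorm hφ x).trans_lt
    (hfg.trans_lt (half_lt_self hε))

theorem precomp_of_condL_of_condB (hφ : IsCompFun φ) {A : Set (X → E)}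
    (hL : CondL φ (A - A)) (hB : CondB (A - A))
    (hx : ∀ x : X, TotallyBounded ((fun f : X → E => f x) '' A)) :
    Precomp (bLipNorm φ) A := by
  intro ε hε
  have hε4 : 0 < ε / 4 := by positivity
  obtain ⟨M, V, hV, hVosc⟩ := hB (ε / 4) hε4
  obtain ⟨N, U, hUne, hU, hUosc⟩ := hL (ε / 4) hε4
  let I := {i : Fin N // (U i).Nonempty}
  let J := {j : Fin M // (V j).Nonempty}
  let p : I → X × X := fun i => i.2.some
  let z : J → X := fun j => j.2.some
  have : Fintype I := Fintype.ofFinite I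
  have : Fintype J := Fintype.ofFinite J
  let c : I → ℝ := fun i => 2 / φ (dist (p i).1 (p i).2)
  have hc : ∀ i, 0 ≤ c i := fun i => div_nonneg zero_le_two (hφ.dist_nonneg _ _)
  have hs : 0 ≤ ∑ i, c i := Finset.sum_nonneg fun i _ => hc i
  obtain ⟨δ, hδ, hδc, hδε⟩ : ∃ δ > 0, (∀ i, δ * c i ≤ ε / 4) ∧ δ ≤ ε / 4 := by
    have h1 : 0 < 1 + ∑ i, c i := by linarith
    have h2 : ∀ a ≤ 1 + ∑ i, c i, ε / 4 / (1 + ∑ i, c i) * a ≤ ε / 4 := fun a ha => by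
      rw [div_mul_eq_mul_div, div_le_iff₀ h1]
      exact mul_le_mul_of_nonneg_left ha hε4.le
    refine ⟨ε / 4 / (1 + ∑ i, c i), by positivity, fun i => h2 _ ?_, ?_⟩
    · linarith [Finset.single_le_sum (fun i _ => hc i) (Finset.mem_univ i)]
    · simpa using h2 1 (by linarith)
  let w : (I ⊕ I) ⊕ J → X := Sum.elim (Sum.elim (fun i => (p i).1) fun i => (p i).2) z
  obtain ⟨T, hTA, hTf, hT⟩ := exists_finite_net_of_eval (fun (f : X → E) k => f (w k))
    (fun k => hx (w k)) hδ
  refine ⟨T, hTA, hTf, fun f hf => ?_⟩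
  obtain ⟨g, hg, hfg⟩ := hT f hf
  refine ⟨g, hg, ?_⟩
  have hmem : f - g ∈ A - A := Set.sub_mem_sub hf (hTA hg)
  have hw : ∀ k, ‖(f - g) (w k)‖ ≤ δ := fun k => by
    rw [Pi.sub_apply, ← dist_eq_norm]
    exact (hfg k).le
  have hnorm : ∀ x, ‖(f - g) x‖ ≤ ε / 2 := fun x => by
    obtain ⟨j, hj⟩ := Set.mem_iUnion.1 (hV.symm ▸ Set.mem_univ x)
    have h1 := hVosc j x hj _ (Set.Nonempty.some_mem ⟨x, hj⟩) (f - g) hmem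
    have h2 := hw (Sum.inr ⟨j, x, hj⟩)
    change ‖(f - g) (Set.Nonempty.some _)‖ ≤ δ at h2
    linarith [(abs_le.1 h1).2]
  have hquot : ∀ q : X × X, q.1 ≠ q.2 → diffQuot φ (f - g) q ≤ ε / 2 := fun q hq => by
    obtain ⟨i, hi⟩ := Set.mem_iUnion.1 (hU hq)
    have h1 : |diffQuot φ (f - g) q - diffQuot φ (f - g) (p ⟨i, q, hi⟩)| ≤ ε / 4 :=
      hUosc i q hi _ (Set.Nonempty.some_mem ⟨q, hi⟩) (f - g) hmem
    have h2 := diffQuot_le_of_norm_le hφ (hw (Sum.inl (Sum.inl ⟨i, q, hi⟩)))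
      (p := p ⟨i, q, hi⟩) (hw (Sum.inl (Sum.inr ⟨i, q, hi⟩)))
    linarith [(abs_le.1 h1).2, hδc ⟨i, q, hi⟩]
  linarith [bLipNorm_le (half_pos hε).le (half_pos hε).le hnorm hquot]

end

/-- **Compactness criterion in `BLip_φ(X,E)`.** -/
theorem stmt_13 {X E : Type*} [MetricSpace X] [NormedAddCommGroup E] [NormedSpace ℝ E]
    (φ : ℝ → ℝ) (hφ : IsCompFun φ)
    (A : Set (X → E)) (hA : A.Nonempty)
    (hAL : ∀ f ∈ A, MemLip φ f ∧ ∃ C : ℝ, ∀ x : X, ‖f x‖ ≤ C) :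
    Precomp (bLipNorm φ) A ↔
      (CondL φ (A - A) ∧ CondB (A - A)) ∧
        ∀ x : X, TotallyBounded ((fun f : X → E => f x) '' A) := by
  exact
  ⟨fun h => ⟨⟨h.condL_sub hφ hAL, h.condB_sub hφ hAL⟩, h.totallyBounded_eval hφ hAL⟩,
    fun h => precomp_of_condL_of_condB hφ h.1.1 h.1.2 h.2⟩
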